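/- Let α, β be real numbers with α > -1/2 and α > β > -1. Then for every f ∈ L_{(α,β)}, lim_{k→∞} ∫_{π/2}^{π} f(θ) R_k^{(α,β)}(cos θ) (sin(θ/2))^{2α+1} (cos(θ/2))^{2β+1} dθ = 0. -/

import Mathlib

open MeasureTheory Filter Set

noncomputable section

/-- Generalized binomial coefficient `C(a, m) = Γ(a+1)/(Γ(m+1)Γ(a-m+1))`. -/
def genBinom (a : ℝ) (m : ℕ) : ℝ :=
  Real.Gamma (a + 1) / (Real.Gamma ((m : ℝ) + 1) * Real.Gamma (a - (m : ℝ) + 1))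

/-- The Jacobi polynomial `P_k^{(α,β)}(x)`. -/
def jacobiP (α β : ℝ) (k : ℕ) (x : ℝ) : ℝ :=
  ∑ s ∈ Finset.range (k + 1),
    genBinom ((k : ℝ) + α) (k - s) * genBinom ((k : ℝ) + β) s *
      ((x - 1) / 2) ^ s * ((x + 1) / 2) ^ (k - s)

/-- The normalized Jacobi polynomial `R_k^{(α,β)}(x) = P_k^{(α,β)}(x)/P_k^{(α,β)}(1)`. -/
def jacobiR (α β : ℝ) (k : ℕ) (x : ℝ) : ℝ := jacobiP α β k x / jacobiP α β k 1

/-- The Jacobi weight `(sin(θ/2))^{2α+1} (cos(θ/2))^{2β+1}`. -/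
def jacobiWeight (α β : ℝ) (θ : ℝ) : ℝ :=
  Real.sin (θ / 2) ^ (2 * α + 1) * Real.cos (θ / 2) ^ (2 * β + 1)

/-- `f ∈ L_{(α,β)}`: `f` is integrable on `[0,π]` against the Jacobi weight. -/
def MemJacobiL (α β : ℝ) (f : ℝ → ℝ) : Prop :=
  IntegrableOn (fun θ => f θ * jacobiWeight α β θ) (Ioc 0 Real.pi)

/-- The norm `‖f‖_{L_{(α,β)}}`. -/
def jacobiNorm (α β : ℝ) (f : ℝ → ℝ) : ℝ :=
  ∫ θ in Ioc (0 : ℝ) Real.pi, |f θ| * jacobiWeight α β θ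

/-- The `k`-th Fourier–Jacobi coefficient `f̂_{(α,β)}(k)`. -/
def fourierJacobi (α β : ℝ) (f : ℝ → ℝ) (k : ℕ) : ℝ :=
  ∫ θ in Ioc (0 : ℝ) Real.pi, f θ * jacobiR α β k (Real.cos θ) * jacobiWeight α β θ

end

lemma genBinom_zero {a : ℝ} (ha : 0 < a + 1) : genBinom a 0 = 1 := by
  have := (Real.Gamma_pos_of_pos ha).ne'
  simp [genBinom, this]

lemma genBinom_succ_mul {a : ℝ} {m : ℕ} (h : 0 < a - m) :
    genBinom a (m + 1) * (m + 1) = genBinom a m * (a - m) := by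
  have h1 : Real.Gamma (a - m + 1) = (a - m) * Real.Gamma (a - m) := Real.Gamma_add_one h.ne'
  have h2 : Real.Gamma ((m : ℝ) + 1 + 1) = (m + 1) * Real.Gamma (m + 1) :=
    Real.Gamma_add_one (by positivity)
  have h3 := (Real.Gamma_pos_of_pos h).ne'
  have h4 : Real.Gamma ((m : ℝ) + 1) ≠ 0 := (Real.Gamma_pos_of_pos (by positivity)).ne'
  have h5 : (m : ℝ) + 1 ≠ 0 := by positivity
  have h6 := h.ne'
  unfold genBinom
  push_cast
  rw [show a - ((m : ℝ) + 1) + 1 = a - m by ring, h1, h2]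
  field_simp

lemma genBinom_add_nat_succ {a : ℝ} (ha : -1 < a) (k : ℕ) :
    genBinom ((k + 1 : ℕ) + a) (k + 1) = genBinom (k + a) k * ((k + 1 + a) / (k + 1)) := by
  have hk : (0 : ℝ) ≤ k := k.cast_nonneg
  have h1 : Real.Gamma ((k : ℝ) + 1 + a + 1) = (k + 1 + a) * Real.Gamma (k + 1 + a) :=
    Real.Gamma_add_one (by linarith)
  have h2 : Real.Gamma ((k : ℝ) + 1 + 1) = (k + 1) * Real.Gamma (k + 1) :=
    Real.Gamma_add_one (by positivity)
  have h4 : Real.Gamma ((k : ℝ) + 1) ≠ 0 := (Real.Gamma_pos_of_pos (by positivity)).ne'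
  have h3 : Real.Gamma (a + 1) ≠ 0 := (Real.Gamma_pos_of_pos (by linarith)).ne'
  have h5 : (k : ℝ) + 1 ≠ 0 := by positivity
  unfold genBinom
  push_cast
  rw [show (k : ℝ) + 1 + a - (k + 1) + 1 = a + 1 by ring, show (k : ℝ) + a - k + 1 = a + 1 by ring,
    show (k : ℝ) + a + 1 = k + 1 + a by ring, h1, h2]
  field_simp

lemma genBinom_add_nat_pos {a : ℝ} (ha : -1 < a) (k : ℕ) : 0 < genBinom (k + a) k := by
  have hk : (0 : ℝ) ≤ k := k.cast_nonneg
  unfold genBinom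
  have h1 := Real.Gamma_pos_of_pos (show 0 < (k : ℝ) + a + 1 by linarith)
  have h2 := Real.Gamma_pos_of_pos (show 0 < (k : ℝ) + 1 by linarith)
  have h3 := Real.Gamma_pos_of_pos (show 0 < (k : ℝ) + a - k + 1 by linarith)
  positivity

lemma genBinom_add_nat_mono {a b : ℝ} (hb : -1 < b) (hba : b ≤ a) (k : ℕ) :
    genBinom (k + b) k ≤ genBinom (k + a) k := by
  have ha : -1 < a := hb.trans_le hba
  induction k with
  | zero => simp [genBinom_zero (show 0 < a + 1 by linarith),
      genBinom_zero (show 0 < b + 1 by linarith)]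
  | succ k ih =>
    have hk : (0 : ℝ) ≤ k := k.cast_nonneg
    rw [genBinom_add_nat_succ ha, genBinom_add_nat_succ hb]
    have := genBinom_add_nat_pos ha k
    have h0 : 0 ≤ ((k : ℝ) + 1 + b) / (k + 1) := div_nonneg (by linarith) (by linarith)
    gcongr

lemma jacobiP_one {α β : ℝ} (hβ : -1 < β) (k : ℕ) :
    jacobiP α β k 1 = genBinom (k + α) k := by
  have hk : (0 : ℝ) ≤ k := k.cast_nonneg
  unfold jacobiP
  rw [Finset.sum_eq_single 0]
  · simp [genBinom_zero (show 0 < (k : ℝ) + β + 1 by linarith)]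
  · intro s _ hs
    simp [hs]
  · simp

lemma jacobiP_neg_one {α β : ℝ} (hα : -1 < α) (k : ℕ) :
    jacobiP α β k (-1) = genBinom (k + β) k * (-1) ^ k := by
  have hk : (0 : ℝ) ≤ k := k.cast_nonneg
  unfold jacobiP
  rw [Finset.sum_eq_single k]
  · norm_num [genBinom_zero (show 0 < (k : ℝ) + α + 1 by linarith)]
  · intro s hs hsk
    have : k - s ≠ 0 := by have := Finset.mem_range.1 hs; omega
    simp [this]
  · simp

/-- The coefficients of `P_k^{(α,β)}` in the basis `((x-1)/2)^s ((x+1)/2)^(k-s)`. -/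
noncomputable def jacobiCoeff (α β : ℝ) (k s : ℕ) : ℝ :=
  genBinom ((k : ℝ) + α) (k - s) * genBinom ((k : ℝ) + β) s

lemma jacobiCoeff_succ {α β : ℝ} (hα : -1 < α) (hβ : -1 < β) {k s : ℕ} (hs : s + 1 ≤ k) :
    jacobiCoeff α β k (s + 1) * ((s + 1) * (s + 1 + α)) =
      jacobiCoeff α β k s * ((k - s) * (k - s + β)) := by
  obtain ⟨m, rfl⟩ := Nat.exists_eq_add_of_le hs
  have hm : (0 : ℝ) ≤ m := m.cast_nonneg
  have hs0 : (0 : ℝ) ≤ s := s.cast_nonneg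
  have h1 : s + 1 + m - s = m + 1 := by omega
  have h2 : s + 1 + m - (s + 1) = m := by omega
  unfold jacobiCoeff
  rw [h1, h2]
  have e1 := genBinom_succ_mul (a := ((s + 1 + m : ℕ) : ℝ) + α) (m := m)
    (by push_cast; linarith)
  have e2 := genBinom_succ_mul (a := ((s + 1 + m : ℕ) : ℝ) + β) (m := s)
    (by push_cast; linarith)
  push_cast at e1 e2 ⊢
  linear_combination (-genBinom (s + 1 + m + β) (s + 1) * (s + 1)) * e1 +
    genBinom (s + 1 + m + α) (m + 1) * (m + 1) * e2

/-- The derivative of `jacobiP`. -/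
noncomputable def jacobiP' (α β : ℝ) (k : ℕ) (x : ℝ) : ℝ :=
  ∑ s ∈ Finset.range (k + 1), jacobiCoeff α β k s *
    (s * ((x - 1) / 2) ^ (s - 1) * ((x + 1) / 2) ^ (k - s) +
      (k - s : ℕ) * ((x - 1) / 2) ^ s * ((x + 1) / 2) ^ (k - s - 1)) / 2

/-- The second derivative of `jacobiP`. -/
noncomputable def jacobiP'' (α β : ℝ) (k : ℕ) (x : ℝ) : ℝ :=
  ∑ s ∈ Finset.range (k + 1), jacobiCoeff α β k s *
    (s * (s - 1 : ℕ) * ((x - 1) / 2) ^ (s - 1 - 1) * ((x + 1) / 2) ^ (k - s) +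
      2 * s * (k - s : ℕ) * ((x - 1) / 2) ^ (s - 1) * ((x + 1) / 2) ^ (k - s - 1) +
      (k - s : ℕ) * (k - s - 1 : ℕ) * ((x - 1) / 2) ^ s * ((x + 1) / 2) ^ (k - s - 1 - 1)) / 4

lemma hasDerivAt_half_pow (c : ℝ) (n : ℕ) (x : ℝ) :
    HasDerivAt (fun x => ((x + c) / 2) ^ n) (n * ((x + c) / 2) ^ (n - 1) / 2) x := by
  have h := (((hasDerivAt_id x).add_const c).div_const 2).pow n
  refine h.congr_deriv ?_
  simp only [id]
  ring

lemma hasDerivAt_jacobiP (α β : ℝ) (k : ℕ) (x : ℝ) :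
    HasDerivAt (jacobiP α β k) (jacobiP' α β k x) x := by
  unfold jacobiP jacobiP'
  refine HasDerivAt.fun_sum fun s _ => ?_
  have h1 := hasDerivAt_half_pow (-1) s x
  have h2 := hasDerivAt_half_pow 1 (k - s) x
  simp only [← sub_eq_add_neg] at h1
  have := (h1.const_mul (jacobiCoeff α β k s)).mul h2
  refine this.congr_deriv ?_
  ring

lemma hasDerivAt_jacobiP' (α β : ℝ) (k : ℕ) (x : ℝ) :
    HasDerivAt (jacobiP' α β k) (jacobiP'' α β k x) x := by
  unfold jacobiP' jacobiP''
  refine HasDerivAt.fun_sum fun s _ => ?_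
  have h1 := hasDerivAt_half_pow (-1) s x
  have h1' := hasDerivAt_half_pow (-1) (s - 1) x
  have h2 := hasDerivAt_half_pow 1 (k - s) x
  have h2' := hasDerivAt_half_pow 1 (k - s - 1) x
  simp only [← sub_eq_add_neg] at h1 h1'
  have := ((((h1'.const_mul (s : ℝ)).mul h2).add
    ((h1.const_mul ((k - s : ℕ) : ℝ)).mul h2')).const_mul (jacobiCoeff α β k s)).div_const 2
  refine this.congr_deriv ?_
  ring

/-- The Jacobi differential operator applied to a single term `u^s v^m`. -/
lemma jacobi_operator_monomial (α β u v : ℝ) (s m : ℕ) :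
    u * v * (s * (s - 1 : ℕ) * u ^ (s - 1 - 1) * v ^ m + 2 * s * m * u ^ (s - 1) * v ^ (m - 1) +
        m * (m - 1 : ℕ) * u ^ s * v ^ (m - 1 - 1)) +
      ((α + 1) * v + (β + 1) * u) * (s * u ^ (s - 1) * v ^ m + m * u ^ s * v ^ (m - 1)) -
      (s + m) * (s + m + α + β + 1) * (u ^ s * v ^ m) =
    s * (s + α) * (u ^ (s - 1) * v ^ (m + 1) - u ^ s * v ^ m) -
      m * (m + β) * (u ^ s * v ^ m - u ^ (s + 1) * v ^ (m - 1)) := by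
  rcases s with _ | _ | s <;> rcases m with _ | _ | m <;> simp <;> ring

lemma jacobi_operator_sum {α β : ℝ} (hα : -1 < α) (hβ : -1 < β) (k : ℕ) (u v : ℝ) :
    ∑ s ∈ Finset.range (k + 1), jacobiCoeff α β k s *
      (s * (s + α) * (u ^ (s - 1) * v ^ (k - s + 1) - u ^ s * v ^ (k - s)) -
      (k - s : ℕ) * ((k - s : ℕ) + β) *
        (u ^ s * v ^ (k - s) - u ^ (s + 1) * v ^ (k - s - 1))) = 0 := by
  have key : ∀ n ≤ k, ∑ s ∈ Finset.range (n + 1), jacobiCoeff α β k s *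
      (s * (s + α) * (u ^ (s - 1) * v ^ (k - s + 1) - u ^ s * v ^ (k - s)) -
      (k - s : ℕ) * ((k - s : ℕ) + β) *
        (u ^ s * v ^ (k - s) - u ^ (s + 1) * v ^ (k - s - 1))) =
      -(jacobiCoeff α β k n * ((k - n : ℕ) * ((k - n : ℕ) + β)) *
        (u ^ n * v ^ (k - n) - u ^ (n + 1) * v ^ (k - n - 1))) := by
    intro n
    induction n with
    | zero => intro _; simp; ring
    | succ n ih =>
      intro hn
      rw [Finset.sum_range_succ, ih (by omega)]
      have hc := jacobiCoeff_succ hα hβ hn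
      have e1 : k - (n + 1) + 1 = k - n := by omega
      have e2 : k - n - 1 = k - (n + 1) := by omega
      rw [e1, e2, Nat.cast_sub (show n ≤ k by omega), Nat.add_sub_cancel]
      push_cast
      linear_combination (u ^ n * v ^ (k - n) - u ^ (n + 1) * v ^ (k - (n + 1))) * hc
  rw [key k le_rfl]
  simp

lemma jacobiP_ode {α β : ℝ} (hα : -1 < α) (hβ : -1 < β) (k : ℕ) (x : ℝ) :
    (1 - x ^ 2) * jacobiP'' α β k x =
      -(k * (k + α + β + 1)) * jacobiP α β k x +
        (α - β + (α + β + 2) * x) * jacobiP' α β k x := by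
  have h := jacobi_operator_sum hα hβ k ((x - 1) / 2) ((x + 1) / 2)
  rw [← sub_eq_zero, ← neg_eq_zero, ← h]
  unfold jacobiP jacobiP' jacobiP''
  rw [Finset.mul_sum, Finset.mul_sum, Finset.mul_sum, ← Finset.sum_add_distrib,
    ← Finset.sum_sub_distrib, ← Finset.sum_neg_distrib]
  refine Finset.sum_congr rfl fun s hs => ?_
  have hs' : s ≤ k := by have := Finset.mem_range.1 hs; omega
  rw [← jacobi_operator_monomial α β, Nat.cast_sub hs']
  unfold jacobiCoeff
  ring

/-- A solution of the Jacobi differential equation with eigenvalue `lam`, together with its first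
two derivatives. -/
structure IsJacobiSolution (α β lam : ℝ) (y y' y'' : ℝ → ℝ) : Prop where
  hasDerivAt : ∀ x, HasDerivAt y (y' x) x
  hasDerivAt' : ∀ x, HasDerivAt y' (y'' x) x
  ode : ∀ x, (1 - x ^ 2) * y'' x = -lam * y x + (α - β + (α + β + 2) * x) * y' x

lemma jacobiR_isJacobiSolution {α β : ℝ} (hα : -1 < α) (hβ : -1 < β) (k : ℕ) :
    IsJacobiSolution α β (k * (k + α + β + 1)) (jacobiR α β k)
      (fun x => jacobiP' α β k x / jacobiP α β k 1)
      (fun x => jacobiP'' α β k x / jacobiP α β k 1) where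
  hasDerivAt x := (hasDerivAt_jacobiP α β k x).div_const _
  hasDerivAt' x := (hasDerivAt_jacobiP' α β k x).div_const _
  ode x := by
    unfold jacobiR
    rw [← mul_div_assoc, jacobiP_ode hα hβ]
    ring

namespace IsJacobiSolution

variable {α β lam : ℝ} {y y' y'' : ℝ → ℝ}

/-- Derivative of the Sonin function. -/
lemma hasDerivAt_sonin (h : IsJacobiSolution α β lam y y' y'') (hl : 0 < lam) (x : ℝ) :
    HasDerivAt (fun x => y x ^ 2 + (1 - x ^ 2) * y' x ^ 2 / lam)
      (2 * (α - β + (α + β + 1) * x) * y' x ^ 2 / lam) x := by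
  have h1 := (h.hasDerivAt x).pow 2
  have h2 := (h.hasDerivAt' x).pow 2
  have h3 := ((hasDerivAt_id x).pow 2).const_sub 1
  refine (h1.add ((h3.mul h2).div_const lam)).congr_deriv ?_
  have ho := h.ode x
  have := hl.ne'
  simp
  field_simp
  linear_combination y' x * ho

/-- Sonin bound for a solution that is at most one in absolute value at the endpoints. -/
lemma sonin_le (h : IsJacobiSolution α β lam y y' y'') (hl : 0 < lam) (hα : -(1 / 2) < α)
    (h1 : y 1 ^ 2 ≤ 1) (h2 : y (-1) ^ 2 ≤ 1) {x : ℝ} (hx : x ∈ Icc (-1 : ℝ) 1) :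
    y x ^ 2 + (1 - x ^ 2) * y' x ^ 2 / lam ≤ 1 := by
  set F : ℝ → ℝ := fun x => y x ^ 2 + (1 - x ^ 2) * y' x ^ 2 / lam with hF
  have hd := h.hasDerivAt_sonin hl
  have hc : Continuous F := continuous_iff_continuousAt.2 fun x => (hd x).continuousAt
  change F x ≤ 1
  rcases le_or_gt 0 (α - β + (α + β + 1) * x) with hq | hq
  · have hm : MonotoneOn F (Icc x 1) := by
      refine monotoneOn_of_hasDerivWithinAt_nonneg (convex_Icc x 1) hc.continuousOn
        (fun t _ => (hd t).hasDerivWithinAt) fun t ht => ?_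
      rw [interior_Icc] at ht
      have : 0 ≤ α - β + (α + β + 1) * t := by nlinarith [ht.1, ht.2]
      positivity
    refine (hm (left_mem_Icc.2 hx.2) (right_mem_Icc.2 hx.2) hx.2).trans ?_
    simpa [hF] using h1
  · have hm : AntitoneOn F (Icc (-1) x) := by
      refine antitoneOn_of_hasDerivWithinAt_nonpos (convex_Icc (-1) x) hc.continuousOn
        (fun t _ => (hd t).hasDerivWithinAt) fun t ht => ?_
      rw [interior_Icc] at ht
      have : α - β + (α + β + 1) * t ≤ 0 := by nlinarith [ht.1, ht.2, hx.2]
      rw [mul_assoc, mul_div_assoc, mul_div_assoc]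
      have : 0 ≤ y' t ^ 2 / lam := by positivity
      nlinarith
    refine (hm (left_mem_Icc.2 hx.1) (right_mem_Icc.2 hx.1) hx.1).trans ?_
    simpa [hF] using h2

/-- Derivative of the weighted and corrected Sonin function. -/
lemma hasDerivAt_weighted_sonin (h : IsJacobiSolution α β lam y y' y'') (hl : 0 < lam) {x : ℝ}
    (hx : x ∈ Ioo (-1 : ℝ) 1) :
    HasDerivAt (fun x => (1 - x) ^ (α + 1 / 2) * (1 + x) ^ (β + 1 / 2) *
        (y x ^ 2 + (1 - x ^ 2) * y' x ^ 2 / lam -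
          (α - β + (α + β + 1) * x) * (y x * y' x / lam)))
      (-((1 - x) ^ (α + 1 / 2) * (1 + x) ^ (β + 1 / 2) *
        ((α + β + 1) + (α - β + (α + β + 1) * x) * x / (1 - x ^ 2))) * (y x * y' x / lam)) x := by
  have p1 : 0 < 1 - x := by linarith [hx.2]
  have p2 : 0 < 1 + x := by linarith [hx.1]
  have p3 : 0 < 1 - x ^ 2 := by nlinarith
  have w1 := ((hasDerivAt_id x).const_sub 1).rpow_const (p := α + 1 / 2) (Or.inl p1.ne')
  have w2 := ((hasDerivAt_id x).const_add 1).rpow_const (p := β + 1 / 2) (Or.inl p2.ne')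
  have q1 := ((hasDerivAt_id x).const_mul (α + β + 1)).const_add (α - β)
  have q2 := ((h.hasDerivAt x).mul (h.hasDerivAt' x)).div_const lam
  have := (w1.mul w2).mul ((h.hasDerivAt_sonin hl x).sub (q1.mul q2))
  refine this.congr_deriv ?_
  have ho := h.ode x
  have hy : y'' x = (-lam * y x + (α - β + (α + β + 2) * x) * y' x) / (1 - x ^ 2) := by
    rw [eq_div_iff p3.ne', ← ho, mul_comm]
  have e : (1 : ℝ) - x ^ 2 = (1 - x) * (1 + x) := by ring
  simp only [id, Pi.mul_apply, Pi.sub_apply]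
  rw [hy, Real.rpow_sub_one p1.ne', Real.rpow_sub_one p2.ne', e]
  have := hl.ne'
  have := p1.ne'
  have := p2.ne'
  generalize (1 - x) ^ (α + 1 / 2) = A
  generalize (1 + x) ^ (β + 1 / 2) = B
  field_simp
  ring

lemma abs_mul_div_le (hl : 0 < lam) {δ a b p : ℝ} (hδ : 0 < δ) (hp : δ ≤ p)
    (hab : a ^ 2 + p * b ^ 2 / lam ≤ 1) : |a * b / lam| ≤ 1 / √(δ * lam) := by
  have hb : 0 ≤ b ^ 2 / lam := by positivity
  have h0 : δ * (b ^ 2 / lam) ≤ p * (b ^ 2 / lam) := by gcongr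
  rw [mul_div_assoc] at hab
  have ha : 0 ≤ a ^ 2 := sq_nonneg a
  have hδb : 0 ≤ δ * (b ^ 2 / lam) := by positivity
  have h3 : a ^ 2 * (δ * (b ^ 2 / lam)) ≤ 1 := by nlinarith
  have : |a * b / lam| ^ 2 ≤ (1 / √(δ * lam)) ^ 2 := by
    rw [sq_abs, div_pow 1, Real.sq_sqrt (by positivity), one_pow, le_div_iff₀ (by positivity)]
    calc (a * b / lam) ^ 2 * (δ * lam) = a ^ 2 * (δ * (b ^ 2 / lam)) := by field_simp
      _ ≤ 1 := h3
  exact le_of_sq_le_sq this (by positivity)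

/-- Interior decay of bounded solutions, uniform in the eigenvalue. -/
lemma exists_weighted_sq_le (α β : ℝ) {x₁ x₂ : ℝ} (h₁ : -1 < x₁) (h₁₂ : x₁ < x₂) (h₂ : x₂ < 1) :
    ∃ C : ℝ, ∀ (lam : ℝ) (y y' y'' : ℝ → ℝ), 0 < lam → IsJacobiSolution α β lam y y' y'' →
      (∀ x ∈ Icc (-1 : ℝ) 1, y x ^ 2 + (1 - x ^ 2) * y' x ^ 2 / lam ≤ 1) →
      (1 - x₁) ^ (α + 1 / 2) * (1 + x₁) ^ (β + 1 / 2) * y x₁ ^ 2 ≤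
        (1 - x₂) ^ (α + 1 / 2) * (1 + x₂) ^ (β + 1 / 2) + C * (1 / √lam) := by
  set W : ℝ → ℝ := fun x => (1 - x) ^ (α + 1 / 2) * (1 + x) ^ (β + 1 / 2) with hW
  set q : ℝ → ℝ := fun x => α - β + (α + β + 1) * x with hq
  set g : ℝ → ℝ := fun x => W x * ((α + β + 1) + q x * x / (1 - x ^ 2)) with hg
  set δ : ℝ := (1 - x₂) * (1 + x₁) with hδ
  have hδ0 : 0 < δ := mul_pos (by linarith) (by linarith)
  have hsub : ∀ x ∈ Icc x₁ x₂, δ ≤ 1 - x ^ 2 := by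
    intro x hx
    have : δ ≤ (1 - x) * (1 + x) :=
      mul_le_mul (by linarith [hx.2]) (by linarith [hx.1]) (by linarith) (by linarith [hx.2])
    linarith
  have hWc : ContinuousOn W (Icc x₁ x₂) := by
    intro x hx
    have p1 : 1 - x ≠ 0 := by linarith [hx.2]
    have p2 : 1 + x ≠ 0 := by linarith [hx.1]
    refine ContinuousAt.continuousWithinAt ?_
    exact (ContinuousAt.rpow_const (by fun_prop) (Or.inl p1)).mul
      (ContinuousAt.rpow_const (by fun_prop) (Or.inl p2))
  have hgc : ContinuousOn g (Icc x₁ x₂) := by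
    refine hWc.mul (continuousOn_const.add (ContinuousOn.div (by fun_prop) (by fun_prop) ?_))
    intro x hx
    linarith [hsub x hx]
  obtain ⟨M, hM⟩ := isCompact_Icc.exists_bound_of_continuousOn hgc
  refine ⟨(M * (x₂ - x₁) + W x₁ * |q x₁| + W x₂ * |q x₂|) * (1 / √δ), ?_⟩
  intro lam y y' y'' hl h hb
  set e : ℝ := 1 / √(δ * lam) with he
  have he' : e = 1 / √δ * (1 / √lam) := by
    rw [he, Real.sqrt_mul hδ0.le, one_div_mul_one_div]
  have he0 : 0 ≤ e := by positivity
  set H : ℝ → ℝ := fun x => W x * (y x ^ 2 + (1 - x ^ 2) * y' x ^ 2 / lam -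
          q x * (y x * y' x / lam)) with hH
  have hW0 : ∀ x ∈ Icc x₁ x₂, 0 ≤ W x := fun x hx =>
    mul_nonneg (Real.rpow_nonneg (by linarith [hx.2]) _) (Real.rpow_nonneg (by linarith [hx.1]) _)
  have hS : ∀ x ∈ Icc x₁ x₂, y x ^ 2 + (1 - x ^ 2) * y' x ^ 2 / lam ≤ 1 := fun x hx =>
    hb x ⟨by linarith [hx.1], by linarith [hx.2]⟩
  have hz : ∀ x ∈ Icc x₁ x₂, |y x * y' x / lam| ≤ e := fun x hx =>
    abs_mul_div_le hl hδ0 (hsub x hx) (hS x hx)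
  have hqz : ∀ x ∈ Icc x₁ x₂, |q x * (y x * y' x / lam)| ≤ |q x| * e := fun x hx => by
    rw [abs_mul]
    exact mul_le_mul_of_nonneg_left (hz x hx) (abs_nonneg _)
  have m1 : x₁ ∈ Icc x₁ x₂ := left_mem_Icc.2 h₁₂.le
  have m2 : x₂ ∈ Icc x₁ x₂ := right_mem_Icc.2 h₁₂.le
  have hmv : ‖H x₁ - H x₂‖ ≤ M * e * ‖x₁ - x₂‖ := by
    refine (convex_Icc x₁ x₂).norm_image_sub_le_of_norm_hasDerivWithin_le
      (f' := fun x => -g x * (y x * y' x / lam)) (fun x hx => ?_) (fun x hx => ?_) m2 m1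
    · exact (h.hasDerivAt_weighted_sonin hl
        ⟨by linarith [hx.1], by linarith [hx.2]⟩).hasDerivWithinAt
    · rw [norm_mul, norm_neg]
      exact mul_le_mul (hM x hx) (hz x hx) (norm_nonneg _) ((norm_nonneg _).trans (hM x hx))
  rw [Real.norm_eq_abs, Real.norm_eq_abs, abs_sub_comm x₁, abs_of_pos (sub_pos.2 h₁₂)] at hmv
  have hH2 : H x₂ ≤ W x₂ * (1 + |q x₂| * e) :=
    mul_le_mul_of_nonneg_left
      (by linarith [hS x₂ m2, neg_abs_le (q x₂ * (y x₂ * y' x₂ / lam)), hqz x₂ m2]) (hW0 x₂ m2)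
  have hpos : 0 ≤ (1 - x₁ ^ 2) * y' x₁ ^ 2 / lam := by
    have := hδ0.le.trans (hsub x₁ m1)
    positivity
  have hH1 : W x₁ * (y x₁ ^ 2 - |q x₁| * e) ≤ H x₁ :=
    mul_le_mul_of_nonneg_left
      (by linarith [le_abs_self (q x₁ * (y x₁ * y' x₁ / lam)), hqz x₁ m1]) (hW0 x₁ m1)
  have := (le_abs_self _).trans hmv
  change W x₁ * y x₁ ^ 2 ≤ W x₂ + _
  rw [mul_assoc _ (1 / √δ), ← he']
  nlinarith

end IsJacobiSolution

lemma tendsto_jacobi_eigenvalue (α β : ℝ) :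
    Tendsto (fun k : ℕ => (k : ℝ) * (k + α + β + 1)) atTop atTop := by
  refine tendsto_natCast_atTop_atTop.atTop_mul_atTop₀ ?_
  simp only [add_assoc]
  exact tendsto_atTop_add_const_right _ _ tendsto_natCast_atTop_atTop

lemma jacobiR_sonin_le {α β : ℝ} (hα : -(1 / 2) < α) (hβ : -1 < β) (hβα : β < α) {k : ℕ}
    (hl : 0 < (k : ℝ) * (k + α + β + 1)) {x : ℝ} (hx : x ∈ Icc (-1 : ℝ) 1) :
    jacobiR α β k x ^ 2 + (1 - x ^ 2) * (jacobiP' α β k x / jacobiP α β k 1) ^ 2 /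
      (k * (k + α + β + 1)) ≤ 1 := by
  have hα' : -1 < α := hβ.trans hβα
  have hp := genBinom_add_nat_pos hα' k
  refine (jacobiR_isJacobiSolution hα' hβ k).sonin_le hl hα ?_ ?_ hx
  · rw [jacobiR, div_self (by rw [jacobiP_one hβ]; exact hp.ne'), one_pow]
  · rw [jacobiR, jacobiP_one hβ, jacobiP_neg_one hα', div_pow, mul_pow, ← pow_mul, mul_comm k,
      pow_mul, neg_one_sq, one_pow, mul_one]
    refine div_le_one_of_le₀ ?_ (by positivity)
    have := genBinom_add_nat_pos hβ k
    have := genBinom_add_nat_mono hβ hβα.le k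
    gcongr

lemma tendsto_jacobiR_zero {α β : ℝ} (hα : -(1 / 2) < α) (hβ : -1 < β) (hβα : β < α) {x : ℝ}
    (hx : x ∈ Ioo (-1 : ℝ) 1) : Tendsto (fun k => jacobiR α β k x) atTop (nhds 0) := by
  set W : ℝ → ℝ := fun x => (1 - x) ^ (α + 1 / 2) * (1 + x) ^ (β + 1 / 2) with hW
  have hWx : 0 < W x :=
    mul_pos (Real.rpow_pos_of_pos (by linarith [hx.2]) _)
      (Real.rpow_pos_of_pos (by linarith [hx.1]) _)
  have hW1 : Tendsto W (nhdsWithin 1 (Iio 1)) (nhds 0) := by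
    have hc : ContinuousAt W 1 :=
      (ContinuousAt.rpow_const (by fun_prop) (Or.inr (by linarith))).mul
        (ContinuousAt.rpow_const (by fun_prop) (Or.inl (by norm_num)))
    have h0 : W 1 = 0 := by simp [hW, Real.zero_rpow (show α + 2⁻¹ ≠ 0 by linarith)]
    rw [← h0]
    exact hc.tendsto.mono_left nhdsWithin_le_nhds
  have hlt := tendsto_jacobi_eigenvalue α β
  have hinv : Tendsto (fun k : ℕ => 1 / √((k : ℝ) * (k + α + β + 1))) atTop (nhds 0) := by
    simp only [one_div]
    exact (Real.tendsto_sqrt_atTop.comp hlt).inv_tendsto_atTop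
  have hsq : Tendsto (fun k => jacobiR α β k x ^ 2) atTop (nhds 0) := by
    refine tendsto_order.2 ⟨fun a ha => Eventually.of_forall fun k => ha.trans_le (sq_nonneg _),
      fun ε hε => ?_⟩
    obtain ⟨x₂, hWx₂, hx₂⟩ := ((hW1.eventually_lt_const
      (show 0 < W x * ε / 2 by positivity)).and (Ioo_mem_nhdsLT hx.2)).exists
    obtain ⟨C, hC⟩ := IsJacobiSolution.exists_weighted_sq_le α β hx.1 hx₂.1 hx₂.2
    have hCt : Tendsto (fun k : ℕ => C * (1 / √((k : ℝ) * (k + α + β + 1)))) atTop (nhds 0) := by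
      simpa using hinv.const_mul C
    filter_upwards [hlt.eventually_gt_atTop 0,
      hCt.eventually_lt_const (show 0 < W x * ε / 2 by positivity)] with k hk hCk
    have h1 := hC _ _ _ _ hk (jacobiR_isJacobiSolution (hβ.trans hβα) hβ k)
      fun t ht => jacobiR_sonin_le hα hβ hβα hk ht
    change W x * _ ≤ W x₂ + _ at h1
    have : W x * jacobiR α β k x ^ 2 < W x * ε := by linarith
    exact lt_of_mul_lt_mul_left this hWx.le
  rw [tendsto_zero_iff_abs_tendsto_zero]
  simpa [Function.comp_def, Real.sqrt_sq_eq_abs] using hsq.sqrt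

/-- For `α > -1/2`, `α > β > -1` and `f ∈ L_{(α,β)}`, the part of the `k`-th
Fourier–Jacobi coefficient coming from `[π/2, π]` tends to `0` as `k → ∞`. -/
theorem jacobi_coeff_second_half_tendsto_zero (α β : ℝ) (hα : -(1/2) < α)
    (hβ : -1 < β) (hβα : β < α) (f : ℝ → ℝ) (hf : MemJacobiL α β f) :
    Tendsto (fun k : ℕ =>
        ∫ θ in Ioc (Real.pi / 2) Real.pi,
          f θ * jacobiR α β k (Real.cos θ) * jacobiWeight α β θ)
      atTop (nhds 0) := by
  have hf' : IntegrableOn (fun θ => f θ * jacobiWeight α β θ) (Ioc (Real.pi / 2) Real.pi) :=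
    hf.mono_set (Ioc_subset_Ioc_left (by positivity))
  have hcomm : ∀ (k : ℕ) (θ : ℝ), f θ * jacobiR α β k (Real.cos θ) * jacobiWeight α β θ =
      f θ * jacobiWeight α β θ * jacobiR α β k (Real.cos θ) := fun _ _ => by ring
  simp only [hcomm]
  have hcont : ∀ k, Continuous fun θ => jacobiR α β k (Real.cos θ) := by
    intro k
    unfold jacobiR jacobiP
    fun_prop
  rw [← integral_zero ℝ ℝ (μ := volume.restrict (Ioc (Real.pi / 2) Real.pi))]
  refine tendsto_integral_filter_of_dominated_convergence
    (fun θ => ‖f θ * jacobiWeight α β θ‖) ?_ ?_ hf'.norm ?_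
  · exact Eventually.of_forall fun k =>
      hf'.aestronglyMeasurable.mul (hcont k).aestronglyMeasurable
  · filter_upwards [(tendsto_jacobi_eigenvalue α β).eventually_gt_atTop 0] with k hk
    refine Eventually.of_forall fun θ => ?_
    rw [norm_mul]
    refine mul_le_of_le_one_right (norm_nonneg _) ?_
    have hc : Real.cos θ ∈ Icc (-1 : ℝ) 1 := ⟨Real.neg_one_le_cos θ, Real.cos_le_one θ⟩
    have h1 := jacobiR_sonin_le hα hβ hβα hk hc
    have h2 : 0 ≤ 1 - Real.cos θ ^ 2 := by nlinarith [hc.1, hc.2]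
    have h3 : 0 ≤ (1 - Real.cos θ ^ 2) * (jacobiP' α β k (Real.cos θ) / jacobiP α β k 1) ^ 2 /
      (k * (k + α + β + 1)) := by positivity
    rw [Real.norm_eq_abs, ← sq_le_one_iff_abs_le_one]
    linarith
  · have hne : ∀ᵐ θ ∂volume.restrict (Ioc (Real.pi / 2) Real.pi), θ ≠ Real.pi :=
      ae_restrict_of_ae (Measure.ae_ne volume Real.pi)
    filter_upwards [hne, ae_restrict_mem measurableSet_Ioc] with θ hθ hm
    have hlt : θ < Real.pi := lt_of_le_of_ne hm.2 hθ
    have h0 : 0 < θ := lt_trans (by positivity) hm.1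
    have hc : Real.cos θ ∈ Ioo (-1 : ℝ) 1 := by
      constructor
      · rw [← Real.cos_pi]
        exact Real.cos_lt_cos_of_nonneg_of_le_pi h0.le le_rfl hlt
      · rw [← Real.cos_zero]
        exact Real.cos_lt_cos_of_nonneg_of_le_pi le_rfl hm.2 h0
    simpa using (tendsto_jacobiR_zero hα hβ hβα hc).const_mul (f θ * jacobiWeight α β θ)
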